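/- Let V be a finite type with |V| = n ≥ 1 and r : V → V → Prop a digraph. Suppose there is a vertex v such that the restriction of r to V \ {v} is acyclic (has no simple cycles). Then r has at most 2^{n-1} simple cycles counted up to cyclic rotation (equivalently, at most 2^{n-1} distinct edge sets of simple cycles). -/

import Mathlib

/-- A simple directed cycle of the digraph `r`: a nonempty list of pairwise distinct
vertices with `r` holding between consecutive entries and from the last entry back to
the first (a single vertex `v` with `r v v` is a simple cycle of length 1). -/
def IsSimpleCycle {V : Type*} (r : V → V → Prop) (l : List V) : Prop :=
  l ≠ [] ∧ l.Nodup ∧ List.Chain' r (l ++ l.take 1)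

/-- The edge set `{(v₀,v₁), …, (v_{k-2},v_{k-1}), (v_{k-1},v₀)}` of the cycle
`l = [v₀, …, v_{k-1}]`, obtained by zipping `l` with its rotation by one;
a simple cycle is determined up to cyclic rotation by its edge set. -/
def cycleEdgeSet {V : Type*} (l : List V) : Set (V × V) :=
  {p | p ∈ l.zip (l.rotate 1)}

theorem exists_eq_append_cons_of_not_nodup {α : Type*} {l : List α} (h : ¬ l.Nodup) :
    ∃ a x b c, l = a ++ (x :: b ++ [x]) ++ c := by
  induction l with
  | nil => simp at h
  | cons y l ih =>
    by_cases hy : y ∈ l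
    · obtain ⟨b, c, rfl⟩ := List.append_of_mem hy
      exact ⟨[], y, b, c, by simp⟩
    · obtain ⟨a, x, b, c, rfl⟩ := ih fun hl => h (List.nodup_cons.2 ⟨hy, hl⟩)
      exact ⟨y :: a, x, b, c, by simp⟩

/-- Every closed walk contains a simple cycle. -/
theorem exists_isSimpleCycle_subset_of_isChain {V : Type*} {r : V → V → Prop} (x : V)
    (l : List V) (h : List.IsChain r (x :: l ++ [x])) :
    ∃ c, IsSimpleCycle r c ∧ c ⊆ x :: l := by
  by_cases hl : (x :: l).Nodup
  · exact ⟨x :: l, ⟨by simp, hl, h⟩, List.Subset.refl _⟩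
  · obtain ⟨a, y, b, c, hab⟩ := exists_eq_append_cons_of_not_nodup hl
    have hlen : b.length < l.length := by
      have := congrArg List.length hab
      simp at this
      omega
    have hin : (y :: b ++ [y]) <:+: x :: l := ⟨a, c, hab.symm⟩
    obtain ⟨d, hd, hsub⟩ := exists_isSimpleCycle_subset_of_isChain y b
      (h.infix (hin.trans (List.prefix_append _ _).isInfix))
    exact ⟨d, hd, fun z hz => hin.subset (List.mem_append_left _ (hsub hz))⟩
termination_by l.length

theorem exists_isChain_avoiding_of_transGen {V : Type*} {r : V → V → Prop} {v a b : V}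
    (h : Relation.TransGen (fun x y => r x y ∧ x ≠ v ∧ y ≠ v) a b) :
    ∃ l, List.IsChain r (a :: l ++ [b]) ∧ v ∉ a :: l := by
  induction h using Relation.TransGen.head_induction_on with
  | single h => exact ⟨[], by simpa using h.1, by simpa using h.2.1.symm⟩
  | head h _ ih =>
    obtain ⟨l, hl, hv⟩ := ih
    refine ⟨_ :: l, List.IsChain.cons_cons h.1 hl, ?_⟩
    rw [List.mem_cons, not_or]
    exact ⟨h.2.1.symm, hv⟩

theorem not_transGen_self_of_acyclic {V : Type*} {r : V → V → Prop} {v : V}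
    (hacyc : ¬ ∃ l : List V, IsSimpleCycle r l ∧ v ∉ l) (a : V) :
    ¬ Relation.TransGen (fun x y => r x y ∧ x ≠ v ∧ y ≠ v) a a := by
  intro h
  obtain ⟨l, hl, hv⟩ := exists_isChain_avoiding_of_transGen h
  obtain ⟨c, hc, hsub⟩ := exists_isSimpleCycle_subset_of_isChain a l hl
  exact hacyc ⟨c, hc, fun hvc => hv (hsub hvc)⟩

theorem IsSimpleCycle.append_comm {V : Type*} {r : V → V → Prop} {a b : List V}
    (h : IsSimpleCycle r (a ++ b)) : IsSimpleCycle r (b ++ a) := by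
  obtain ⟨hne, hnd, hch⟩ := h
  refine ⟨by simpa [and_comm] using hne, (List.perm_append_comm.nodup_iff).1 hnd, ?_⟩
  cases a with
  | nil => simpa using hch
  | cons x a =>
    cases b with
    | nil => simpa using hch
    | cons y b =>
      have hch : List.IsChain r ((x :: a) ++ y :: (b ++ [x])) := by
        simpa [List.Chain'] using hch
      obtain ⟨h₁, h₂⟩ := List.isChain_split.1 hch
      have : List.IsChain r ((y :: b) ++ x :: (a ++ [y])) := List.isChain_split.2 ⟨h₂, h₁⟩
      simpa [List.Chain'] using this

theorem cycleEdgeSet_rotate {V : Type*} (l : List V) (n : ℕ) :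
    cycleEdgeSet (l.rotate n) = cycleEdgeSet l := by
  ext p
  have h : (l.rotate n).zip ((l.rotate n).rotate 1) = (l.zip (l.rotate 1)).rotate n := by
    rw [List.rotate_rotate, Nat.add_comm, ← List.rotate_rotate]
    exact (List.zipWith_rotate_distrib Prod.mk _ _ n (by simp)).symm
  simp only [cycleEdgeSet, Set.mem_ofPred_eq, h, List.mem_rotate]

theorem IsSimpleCycle.exists_cons_of_mem {V : Type*} {r : V → V → Prop} {l : List V} {v : V}
    (h : IsSimpleCycle r l) (hv : v ∈ l) :
    ∃ t, IsSimpleCycle r (v :: t) ∧ cycleEdgeSet l = cycleEdgeSet (v :: t) := by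
  obtain ⟨a, b, rfl⟩ := List.append_of_mem hv
  refine ⟨b ++ a, h.append_comm, ?_⟩
  rw [← cycleEdgeSet_rotate _ a.length, List.rotate_append_length_eq, List.cons_append]

theorem IsSimpleCycle.pairwise_transGen_tail {V : Type*} {r : V → V → Prop} {v : V}
    {t : List V} (h : IsSimpleCycle r (v :: t)) :
    t.Pairwise (Relation.TransGen fun x y => r x y ∧ x ≠ v ∧ y ≠ v) := by
  obtain ⟨-, hnd, hch⟩ := h
  have hv := (List.nodup_cons.1 hnd).1
  have ht : List.IsChain r t := List.IsChain.infix hch ⟨[v], [v], by simp⟩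
  exact (ht.imp_of_mem_imp fun x y hx hy hxy => Relation.TransGen.single
    ⟨hxy, ne_of_mem_of_not_mem hx hv, ne_of_mem_of_not_mem hy hv⟩).pairwise

/-- If every cycle passes through `v`, a cycle starting at `v` is determined by its vertices. -/
theorem IsSimpleCycle.tail_eq_of_perm {V : Type*} {r : V → V → Prop} {v : V}
    (hacyc : ¬ ∃ l : List V, IsSimpleCycle r l ∧ v ∉ l) {s t : List V}
    (hs : IsSimpleCycle r (v :: s)) (ht : IsSimpleCycle r (v :: t)) (hst : s.Perm t) : s = t :=
  hst.eq_of_pairwise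
    (fun a _ _ _ hab hba => (not_transGen_self_of_acyclic hacyc a (hab.trans hba)).elim)
    hs.pairwise_transGen_tail ht.pairwise_transGen_tail

/-- Let `r` be a digraph on a finite type of cardinality `n ≥ 1` and
suppose there is a vertex `v` such that the restriction of `r` to `V \ {v}` is acyclic,
i.e. `r` has no simple cycle avoiding `v`. Then `r` has at most `2^(n-1)` simple cycles
counted up to cyclic rotation (distinct edge sets of simple cycles). -/
theorem card_cycles_le_of_acyclic_off_vertex {V : Type*} [Fintype V] (r : V → V → Prop)
    (hn : 1 ≤ Fintype.card V) (v : V)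
    (hacyc : ¬ ∃ l : List V, IsSimpleCycle r l ∧ v ∉ l) :
    Set.ncard {E : Set (V × V) | ∃ l, IsSimpleCycle r l ∧ E = cycleEdgeSet l}
      ≤ 2 ^ (Fintype.card V - 1) := by
  classical
  have key : ∀ E ∈ {E : Set (V × V) | ∃ l, IsSimpleCycle r l ∧ E = cycleEdgeSet l},
      ∃ t, IsSimpleCycle r (v :: t) ∧ E = cycleEdgeSet (v :: t) := by
    rintro E ⟨l, hl, rfl⟩
    exact hl.exists_cons_of_mem (by_contra fun hv => hacyc ⟨l, hl, hv⟩)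
  choose! f hf hfE using key
  have hcard : (((Finset.univ.erase v).powerset : Finset (Finset V)) :
      Set (Finset V)).ncard = 2 ^ (Fintype.card V - 1) := by
    rw [Set.ncard_coe_finset, Finset.card_powerset, Finset.card_erase_of_mem (Finset.mem_univ v),
      Finset.card_univ]
  rw [← hcard]
  refine Set.ncard_le_ncard_of_injOn (fun E => (f E).toFinset) (fun E hE => ?_)
    (fun E hE F hF h => ?_) (Finset.finite_toSet _)
  · have hv := (List.nodup_cons.1 (hf E hE).2.1).1
    rw [Finset.mem_coe, Finset.mem_powerset]
    exact fun x hx => Finset.mem_erase.2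
      ⟨ne_of_mem_of_not_mem (List.mem_toFinset.1 hx) hv, Finset.mem_univ x⟩
  · have hperm := List.perm_of_nodup_nodup_toFinset_eq (List.nodup_cons.1 (hf E hE).2.1).2
      (List.nodup_cons.1 (hf F hF).2.1).2 h
    rw [hfE E hE, hfE F hF, (hf E hE).tail_eq_of_perm hacyc (hf F hF) hperm]
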